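/- (Joint Gaussian tail bound, vanishing correlation.) Let (W_1, W_2) = (W_1^{(n)}, W_2^{(n)}) be jointly centered Gaussian with variances 1+b_n^{(1)} and 1+b_n^{(2)}, where b_n^{(1)} = o(1) and b_n^{(2)} = o(1), and with correlation coefficient α_n ∈ [0,1] satisfying α_n → 0. Then for any sequence t_n → ∞ and all sufficiently large n, P(W_1 > t_n, W_2 > t_n) ≤ exp( −8 t_n² / (1+b_n^{(1)}) ) + exp( O(α_n t_n²) ) · P(W_1 > t_n) · P(W_2 > t_n). -/

import Mathlib

open MeasureTheory ProbabilityTheory Real Filter Topology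

noncomputable section

/-- the law of a pair of independent standard Gaussians -/
def gauss2 : Measure (ℝ × ℝ) := (gaussianReal 0 1).prod (gaussianReal 0 1)

/-- `W₁ = √(1+b₁) G₁`: a centered Gaussian with variance `1+b₁` -/
def W1 (b1 : ℝ) (p : ℝ × ℝ) : ℝ := Real.sqrt (1 + b1) * p.1

/-- `W₂ = √(1+b₂)(α G₁ + √(1−α²) G₂)`: a centered Gaussian with variance `1+b₂` whose
correlation with `W₁` is `α`; together `(W₁, W₂)` is the generic centered bivariate
Gaussian with variances `1+b₁, 1+b₂` and correlation `α ∈ [0,1]`. -/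
def W2 (b2 α : ℝ) (p : ℝ × ℝ) : ℝ :=
  Real.sqrt (1 + b2) * (α * p.1 + Real.sqrt (1 - α ^ 2) * p.2)

section GaussianTail

open Set

lemma gaussianPDFReal_zero_one_apply (x : ℝ) :
    gaussianPDFReal 0 1 x = (√(2 * π))⁻¹ * exp (-x ^ 2 / 2) := by
  simp [gaussianPDFReal]

lemma gaussianPDFReal_zero_one_antitoneOn : AntitoneOn (gaussianPDFReal 0 1) (Ici 0) := by
  intro x hx y _ hxy
  have hx0 : 0 ≤ x := hx
  rw [gaussianPDFReal_zero_one_apply, gaussianPDFReal_zero_one_apply]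
  gcongr

lemma gaussianReal_real_eq_setIntegral (s : Set ℝ) :
    (gaussianReal 0 1).real s = ∫ x in s, gaussianPDFReal 0 1 x := by
  rw [Measure.real, gaussianReal_apply_eq_integral 0 one_ne_zero,
    ENNReal.toReal_ofReal (integral_nonneg fun x => gaussianPDFReal_nonneg 0 1 x)]

lemma gaussianReal_real_Ioc_le {a b : ℝ} (ha : 0 ≤ a) (hab : a ≤ b) :
    (gaussianReal 0 1).real (Ioc a b) ≤ (b - a) * gaussianPDFReal 0 1 a := by
  have h : ∫ x in Ioc a b, gaussianPDFReal 0 1 x ≤ ∫ _ in Ioc a b, gaussianPDFReal 0 1 a :=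
    setIntegral_mono_on (integrable_gaussianPDFReal 0 1).integrableOn
      (integrableOn_const (by simp)) measurableSet_Ioc fun x hx =>
        gaussianPDFReal_zero_one_antitoneOn ha (ha.trans hx.1.le) hx.1.le
  rw [gaussianReal_real_eq_setIntegral]
  simpa [hab] using h

lemma le_gaussianReal_real_Ioc {a b : ℝ} (ha : 0 ≤ a) (hab : a ≤ b) :
    (b - a) * gaussianPDFReal 0 1 b ≤ (gaussianReal 0 1).real (Ioc a b) := by
  have h : ∫ _ in Ioc a b, gaussianPDFReal 0 1 b ≤ ∫ x in Ioc a b, gaussianPDFReal 0 1 x :=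
    setIntegral_mono_on (integrableOn_const (by simp))
      (integrable_gaussianPDFReal 0 1).integrableOn measurableSet_Ioc fun x hx =>
        gaussianPDFReal_zero_one_antitoneOn (ha.trans hx.1.le) (ha.trans hab) hx.2
  rw [gaussianReal_real_eq_setIntegral]
  simpa [hab] using h

/-- A lower Mills-ratio bound for the standard Gaussian tail. -/
lemma gaussianPDFReal_le_mul_tail {s : ℝ} (hs : 1 ≤ s) :
    gaussianPDFReal 0 1 s ≤ 8 * s * (gaussianReal 0 1).real (Ioi s) := by
  have hs0 : 0 < s := by linarith
  have h1 : (s + 1 / s - s) * gaussianPDFReal 0 1 (s + 1 / s) ≤ (gaussianReal 0 1).real (Ioi s) :=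
    (le_gaussianReal_real_Ioc hs0.le (by simp [hs0.le])).trans (measureReal_mono Ioc_subset_Ioi_self)
  have h2 : gaussianPDFReal 0 1 s ≤ 8 * gaussianPDFReal 0 1 (s + 1 / s) := by
    have hinv : (1 / s) ^ 2 ≤ 1 := by
      rw [div_pow, one_pow, div_le_one (by positivity)]
      nlinarith
    have he : exp (-s ^ 2 / 2) ≤ exp 2 * exp (-(s + 1 / s) ^ 2 / 2) := by
      rw [← exp_add]
      gcongr
      have : s * (1 / s) = 1 := by field_simp
      nlinarith
    have h8 : exp 2 ≤ 8 := by
      have h := exp_one_lt_d9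
      have : exp 2 = exp 1 * exp 1 := by rw [← exp_add]; norm_num
      nlinarith [exp_pos 1]
    rw [gaussianPDFReal_zero_one_apply, gaussianPDFReal_zero_one_apply, mul_left_comm]
    gcongr
    exact he.trans (by gcongr)
  calc gaussianPDFReal 0 1 s ≤ 8 * gaussianPDFReal 0 1 (s + 1 / s) := h2
    _ = 8 * s * ((s + 1 / s - s) * gaussianPDFReal 0 1 (s + 1 / s)) := by field_simp; ring
    _ ≤ _ := by gcongr

/-- Shifting the threshold of a Gaussian tail by `δ` costs at most a factor `exp (9 δ s)`. -/
lemma gaussianReal_tail_sub_le {s δ : ℝ} (hs : 1 ≤ s) (hδ : 0 ≤ δ) (hδs : δ ≤ s) :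
    (gaussianReal 0 1).real (Ioi (s - δ)) ≤
      exp (9 * (δ * s)) * (gaussianReal 0 1).real (Ioi s) := by
  have hsplit : (gaussianReal 0 1).real (Ioi (s - δ)) =
      (gaussianReal 0 1).real (Ioc (s - δ) s) + (gaussianReal 0 1).real (Ioi s) := by
    rw [← measureReal_union (Ioc_disjoint_Ioi le_rfl) measurableSet_Ioi,
      Ioc_union_Ioi_eq_Ioi (by linarith)]
  have hIoc : (gaussianReal 0 1).real (Ioc (s - δ) s) ≤ δ * gaussianPDFReal 0 1 (s - δ) := by
    simpa using gaussianReal_real_Ioc_le (a := s - δ) (b := s) (by linarith) (by linarith)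
  have hpdf : gaussianPDFReal 0 1 (s - δ) ≤ exp (δ * s) * gaussianPDFReal 0 1 s := by
    rw [gaussianPDFReal_zero_one_apply, gaussianPDFReal_zero_one_apply, mul_left_comm, ← exp_add]
    gcongr
    nlinarith [sq_nonneg δ]
  have hy : 0 ≤ δ * s := by positivity
  have hexp : 8 * (δ * s) * exp (δ * s) + 1 ≤ exp (9 * (δ * s)) := by
    have h1 : exp (9 * (δ * s)) = exp (8 * (δ * s)) * exp (δ * s) := by
      rw [← exp_add]; ring_nf
    have h2 := add_one_le_exp (8 * (δ * s))
    have h3 := one_le_exp hy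
    nlinarith
  calc (gaussianReal 0 1).real (Ioi (s - δ))
      ≤ δ * (exp (δ * s) * (8 * s * (gaussianReal 0 1).real (Ioi s))) +
          (gaussianReal 0 1).real (Ioi s) := by
        rw [hsplit]
        gcongr
        refine hIoc.trans ?_
        gcongr
        refine hpdf.trans ?_
        gcongr
        exact gaussianPDFReal_le_mul_tail hs
    _ = (8 * (δ * s) * exp (δ * s) + 1) * (gaussianReal 0 1).real (Ioi s) := by ring
    _ ≤ _ := by gcongr

/-- The Chernoff bound for the standard Gaussian tail. -/
lemma gaussianReal_tail_le_exp {x : ℝ} (hx : 0 ≤ x) :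
    (gaussianReal 0 1).real (Ioi x) ≤ exp (-x ^ 2 / 2) := by
  have h : HasSubgaussianMGF id 1 (gaussianReal 0 1) :=
    ⟨fun t => integrable_exp_mul_gaussianReal t, fun t => by simp [mgf_id_gaussianReal]⟩
  have hmono : (gaussianReal 0 1).real (Ioi x) ≤ (gaussianReal 0 1).real {y | x ≤ id y} :=
    measureReal_mono Ioi_subset_Ici_self
  exact hmono.trans (by simpa using h.measure_ge_le hx)

lemma gauss2_map_rotation {α : ℝ} (hα : α ^ 2 ≤ 1) :
    gauss2.map (fun p => α * p.1 + √(1 - α ^ 2) * p.2) = gaussianReal 0 1 := by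
  have hind : IndepFun (fun p : ℝ × ℝ => α * p.1) (fun p => √(1 - α ^ 2) * p.2) gauss2 :=
    indepFun_prod (X := fun x : ℝ => α * x) (Y := fun x : ℝ => √(1 - α ^ 2) * x)
      (by fun_prop) (by fun_prop)
  have hfst : gauss2.map Prod.fst = gaussianReal 0 1 := by simp [gauss2, Measure.map_fst_prod]
  have hsnd : gauss2.map Prod.snd = gaussianReal 0 1 := by simp [gauss2, Measure.map_snd_prod]
  have h1 := (gaussianReal_const_mul ⟨by fun_prop, hfst⟩ α).map_eq
  have h2 := (gaussianReal_const_mul ⟨by fun_prop, hsnd⟩ √(1 - α ^ 2)).map_eq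
  refine (gaussianReal_add_gaussianReal_of_indepFun hind h1 h2).trans ?_
  congr 1
  · simp
  · ext
    simp [sq_sqrt (sub_nonneg.2 hα)]

lemma gauss2_W1_tail {b t : ℝ} (hb : 0 < 1 + b) :
    (gauss2 {p | t < W1 b p}).toReal = (gaussianReal 0 1).real (Ioi (t / √(1 + b))) := by
  have hset : {p : ℝ × ℝ | t < W1 b p} = Ioi (t / √(1 + b)) ×ˢ univ := by
    ext p
    simp [W1, div_lt_iff₀' (sqrt_pos.2 hb)]
  rw [hset, gauss2, Measure.prod_prod, measure_univ, mul_one, Measure.real]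

lemma gauss2_W2_tail {b α t : ℝ} (hb : 0 < 1 + b) (hα : α ^ 2 ≤ 1) :
    (gauss2 {p | t < W2 b α p}).toReal = (gaussianReal 0 1).real (Ioi (t / √(1 + b))) := by
  rw [Measure.real, ← gauss2_map_rotation hα,
    Measure.map_apply (by fun_prop) measurableSet_Ioi]
  congr 2
  ext p
  simp [W2, div_lt_iff₀' (sqrt_pos.2 hb)]

/-- Truncating the first coordinate at `4 s₁`, with `sᵢ = t / √(1 + bᵢ)`, decouples the joint
tail. -/
lemma gauss2_joint_tail_le {b1 b2 α t : ℝ} (hb1 : 0 < 1 + b1) (hb2 : 0 < 1 + b2)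
    (hα : 0 ≤ α) (ht : 0 ≤ t) (hs : 4 * α * (t / √(1 + b1)) ≤ t / √(1 + b2)) :
    (gauss2 {p | t < W1 b1 p ∧ t < W2 b2 α p}).toReal ≤
      exp (-8 * t ^ 2 / (1 + b1)) + (gaussianReal 0 1).real (Ioi (t / √(1 + b1))) *
        (gaussianReal 0 1).real (Ioi (t / √(1 + b2) - 4 * α * (t / √(1 + b1)))) := by
  have hprob : IsProbabilityMeasure gauss2 := by unfold gauss2; infer_instance
  have hchern : (gaussianReal 0 1).real (Ioi (4 * (t / √(1 + b1)))) ≤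
      exp (-8 * t ^ 2 / (1 + b1)) := by
    refine (gaussianReal_tail_le_exp (by positivity)).trans_eq ?_
    rw [mul_pow, div_pow, sq_sqrt hb1.le]
    ring_nf
  set s₁ := t / √(1 + b1)
  set s₂ := t / √(1 + b2)
  have hsub : {p : ℝ × ℝ | t < W1 b1 p ∧ t < W2 b2 α p} ⊆
      Ioi (4 * s₁) ×ˢ univ ∪ Ioi s₁ ×ˢ Ioi (s₂ - 4 * α * s₁) := by
    rintro ⟨x, y⟩ ⟨h1, h2⟩
    replace h1 : s₁ < x := (div_lt_iff₀' (sqrt_pos.2 hb1)).2 h1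
    replace h2 : s₂ < α * x + √(1 - α ^ 2) * y := (div_lt_iff₀' (sqrt_pos.2 hb2)).2 h2
    rcases lt_or_ge (4 * s₁) x with hx | hx
    · exact Or.inl ⟨hx, mem_univ _⟩
    · refine Or.inr ⟨h1, ?_⟩
      have hβ0 := sqrt_nonneg (1 - α ^ 2)
      have hβ1 : √(1 - α ^ 2) ≤ 1 := sqrt_le_one.2 (by nlinarith)
      have hαx := mul_le_mul_of_nonneg_left hx hα
      have hβy : s₂ - 4 * α * s₁ < √(1 - α ^ 2) * y := by nlinarith
      have hy : 0 < y := pos_of_mul_pos_right (lt_of_le_of_lt (by linarith) hβy) hβ0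
      show s₂ - 4 * α * s₁ < y
      nlinarith
  calc (gauss2 {p | t < W1 b1 p ∧ t < W2 b2 α p}).toReal
      ≤ gauss2.real (Ioi (4 * s₁) ×ˢ univ ∪ Ioi s₁ ×ˢ Ioi (s₂ - 4 * α * s₁)) :=
        measureReal_mono hsub
    _ ≤ gauss2.real (Ioi (4 * s₁) ×ˢ univ) + gauss2.real (Ioi s₁ ×ˢ Ioi (s₂ - 4 * α * s₁)) :=
        measureReal_union_le _ _
    _ = (gaussianReal 0 1).real (Ioi (4 * s₁)) +
          (gaussianReal 0 1).real (Ioi s₁) * (gaussianReal 0 1).real (Ioi (s₂ - 4 * α * s₁)) := by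
        simp [gauss2, measureReal_prod_prod]
    _ ≤ _ := by gcongr

lemma div_sqrt_mem_Icc {v t : ℝ} (ht : 0 ≤ t) (hv : v ∈ Icc (1 / 4 : ℝ) 4) :
    t / √v ∈ Icc (t / 2) (2 * t) := by
  have h1 : √v ≤ 2 := sqrt_le_iff.2 ⟨by norm_num, by linarith [hv.2]⟩
  have h2 : 1 / 2 ≤ √v := le_sqrt_of_sq_le (by linarith [hv.1])
  have h0 : 0 < √v := by linarith
  constructor
  · gcongr
  · rw [div_le_iff₀ h0]
    nlinarith

end GaussianTail

/-- **Joint Gaussian tail bound, vanishing correlation (Lemma C.3 (ii)).**  If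
`(W₁, W₂) = (W₁⁽ⁿ⁾, W₂⁽ⁿ⁾)` is jointly centered Gaussian with variances `1+b₁ₙ`, `1+b₂ₙ`
(`b₁ₙ, b₂ₙ = o(1)`) and correlation `αₙ ∈ [0,1]`, `αₙ → 0`, then for any sequence
`tₙ → ∞` and all sufficiently large `n`,
`P(W₁ > tₙ, W₂ > tₙ) ≤ exp(−8tₙ²/(1+b₁ₙ)) + exp(O(αₙtₙ²)) P(W₁ > tₙ) P(W₂ > tₙ)`. -/
theorem joint_gaussian_tail_vanishing_correlation (b1 b2 α t : ℕ → ℝ)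
    (hb1 : Tendsto b1 atTop (𝓝 0)) (hb2 : Tendsto b2 atTop (𝓝 0))
    (hb1' : ∀ n, 0 ≤ 1 + b1 n) (hb2' : ∀ n, 0 ≤ 1 + b2 n)
    (hα : ∀ n, α n ∈ Set.Icc (0 : ℝ) 1) (hα0 : Tendsto α atTop (𝓝 0))
    (ht : Tendsto t atTop atTop) :
    ∃ c > (0 : ℝ), ∀ᶠ n : ℕ in atTop,
      (gauss2 {p | t n < W1 (b1 n) p ∧ t n < W2 (b2 n) (α n) p}).toReal ≤
        Real.exp (-8 * (t n) ^ 2 / (1 + b1 n)) +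
          Real.exp (c * α n * (t n) ^ 2) *
            (gauss2 {p | t n < W1 (b1 n) p}).toReal *
            (gauss2 {p | t n < W2 (b2 n) (α n) p}).toReal := by
  refine ⟨144, by norm_num, ?_⟩
  have hvar : ∀ b : ℕ → ℝ, Tendsto b atTop (𝓝 0) →
      ∀ᶠ n in atTop, 1 + b n ∈ Set.Icc (1 / 4 : ℝ) 4 := fun b hb =>
    (by simpa using hb.const_add 1 : Tendsto (fun n => 1 + b n) atTop (𝓝 1)).eventually
      (Icc_mem_nhds (by norm_num) (by norm_num))
  filter_upwards [hvar b1 hb1, hvar b2 hb2, ht.eventually_ge_atTop 2,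
    hα0.eventually_le_const (show (0 : ℝ) < 1 / 16 by norm_num)] with n h1 h2 htn hαn
  have hα_nonneg := (hα n).1
  have hv1 : 0 < 1 + b1 n := by linarith [h1.1]
  have hv2 : 0 < 1 + b2 n := by linarith [h2.1]
  have hs1 := div_sqrt_mem_Icc (by linarith) h1 (t := t n)
  have hs2 := div_sqrt_mem_Icc (by linarith) h2 (t := t n)
  have hshift : 4 * α n * (t n / √(1 + b1 n)) ≤ t n / √(1 + b2 n) := by
    nlinarith [hs1.1, hs1.2, hs2.1, mul_le_mul hαn hs1.2 (by linarith [hs1.1]) (by norm_num)]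
  refine (gauss2_joint_tail_le hv1 hv2 hα_nonneg (by linarith) hshift).trans ?_
  rw [gauss2_W1_tail hv1, gauss2_W2_tail hv2 (pow_le_one₀ hα_nonneg (hα n).2)]
  have hs1_nonneg : 0 ≤ t n / √(1 + b1 n) := by linarith [hs1.1]
  have hs2_nonneg : 0 ≤ t n / √(1 + b2 n) := by linarith [hs2.1]
  have htail := gaussianReal_tail_sub_le (by linarith [hs2.1]) (by positivity) hshift
  have hexponent : 9 * (4 * α n * (t n / √(1 + b1 n)) * (t n / √(1 + b2 n))) ≤
      144 * α n * t n ^ 2 := by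
    calc 9 * (4 * α n * (t n / √(1 + b1 n)) * (t n / √(1 + b2 n)))
        ≤ 9 * (4 * α n * (2 * t n) * (2 * t n)) := by gcongr; exacts [hs1.2, hs2.2]
      _ = 144 * α n * t n ^ 2 := by ring
  rw [mul_assoc (exp _), mul_left_comm (exp _)]
  gcongr
  exact htail.trans (by gcongr)
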